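/- arXiv:2508.14648 — 2 statements merged into one kernel-verified Lean document; each statement's English description precedes it below -/
import Mathlib

section
/- Classical influence-function derivative: let θ* be a point at which the gradient map ∇L is differentiable with Fréchet derivative H, and suppose H is invertible as a continuous linear equivalence. Let φ : ℝ → EuclideanSpace ℝ (Fin p) be differentiable at 0 with φ(0) = θ*, suppose the gradient map ∇ℓⱼ of the per-sample loss ℓ j is continuous at θ*, and suppose the stationarity condition ∇L(φ(ε)) + ε • ∇ℓⱼ(φ(ε)) = 0 holds for all ε in a neighborhood of 0. Then the derivative of φ at 0 equals −H⁻¹ (∇ℓⱼ(θ*)). -/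
open Filter

/-- The product of the identity with a map that is merely continuous at `0` is differentiable
at `0`. -/
theorem ContinuousAt.hasDerivAt_id_smul {𝕜 E : Type*} [NontriviallyNormedField 𝕜]
    [NormedAddCommGroup E] [NormedSpace 𝕜 E] {g : 𝕜 → E} (hg : ContinuousAt g 0) :
    HasDerivAt (fun t => t • g t) (g 0) 0 := by
  rw [hasDerivAt_iff_tendsto_slope]
  refine (hg.tendsto.mono_left nhdsWithin_le_nhds).congr' ?_
  filter_upwards [self_mem_nhdsWithin] with t ht
  simp [slope_def_module, inv_smul_smul₀ (show t ≠ 0 from ht)]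

/-- Implicit differentiation of `F (φ t) + t • G (φ t) = 0` at `t = 0`, with `G` only continuous
at `φ 0`. -/
theorem DifferentiableAt.deriv_eq_of_add_smul_eq_zero {𝕜 E F' : Type*}
    [NontriviallyNormedField 𝕜] [NormedAddCommGroup E] [NormedSpace 𝕜 E]
    [NormedAddCommGroup F'] [NormedSpace 𝕜 F'] {F G : E → F'} {H : E ≃L[𝕜] F'} {φ : 𝕜 → E}
    (hφ : DifferentiableAt 𝕜 φ 0) (hF : HasFDerivAt F (H : E →L[𝕜] F') (φ 0))
    (hG : ContinuousAt G (φ 0)) (h : ∀ᶠ t in nhds (0 : 𝕜), F (φ t) + t • G (φ t) = 0) :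
    deriv φ 0 = -H.symm (G (φ 0)) := by
  have hGφ : ContinuousAt (fun t => G (φ t)) 0 :=
    ContinuousAt.comp (g := G) hG hφ.continuousAt
  have hsum := (hF.comp_hasDerivAt 0 hφ.hasDerivAt).add hGφ.hasDerivAt_id_smul
  have hzero : H (deriv φ 0) + G (φ 0) = 0 :=
    hsum.unique ((hasDerivAt_const (0 : 𝕜) (0 : F')).congr_of_eventuallyEq h)
  rw [← map_neg, ← eq_neg_of_add_eq_zero_left hzero, H.symm_apply_apply]

/-- Classical influence-function derivative: if the gradient map `∇L` is differentiable
at `θ*` with invertible Hessian `H`, `φ : ℝ → E` is differentiable at `0` with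
`φ 0 = θ*`, the gradient map of `ℓ j` is continuous at `θ*`, and the stationarity
condition `∇L(φ(ε)) + ε • ∇ℓⱼ(φ(ε)) = 0` holds for all `ε` near `0`, then
`deriv φ 0 = −H⁻¹(∇ℓⱼ(θ*))`. -/
theorem influence_function_derivative
    (p N : ℕ) (hN : 2 ≤ N)
    (ℓ : Fin N → EuclideanSpace ℝ (Fin p) → ℝ) (j : Fin N)
    (θstar : EuclideanSpace ℝ (Fin p))
    (H : EuclideanSpace ℝ (Fin p) ≃L[ℝ] EuclideanSpace ℝ (Fin p))
    (hH : HasFDerivAt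
      (fun x => gradient (fun y => (1 / (N : ℝ)) * ∑ i, ℓ i y) x)
      (H : EuclideanSpace ℝ (Fin p) →L[ℝ] EuclideanSpace ℝ (Fin p)) θstar)
    (φ : ℝ → EuclideanSpace ℝ (Fin p))
    (hφ : DifferentiableAt ℝ φ 0) (hφ0 : φ 0 = θstar)
    (hcont : ContinuousAt (fun x => gradient (ℓ j) x) θstar)
    (hstat : ∀ᶠ ε in nhds (0 : ℝ),
      gradient (fun y => (1 / (N : ℝ)) * ∑ i, ℓ i y) (φ ε) +
        ε • gradient (ℓ j) (φ ε) = 0) :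
    deriv φ 0 = -H.symm (gradient (ℓ j) θstar) := by
  subst hφ0
  exact hφ.deriv_eq_of_add_smul_eq_zero hH hcont hstat
end

section
/- One-step stability of the leave-one-out parameter gap: assume each per-sample loss ℓ i is differentiable with ‖∇ℓᵢ(θ)‖ ≤ g for all θ, the full-batch gradient map ∇L is K-Lipschitz, and η t ≥ 0. Then the influence on parameters satisfies the recursive bound ‖θ₋ⱼ^{t+1} − θ^{t+1}‖ ≤ (1 + η t · K) ‖θ₋ⱼ^t − θ^t‖ + 2 η t g/(N−1). -/
/-- The gradient of a scaled finite sum of differentiable functions is the scaled sum of their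
gradients. -/
theorem gradient_const_mul_sum {ι E : Type*} [NormedAddCommGroup E] [InnerProductSpace ℝ E]
    [CompleteSpace E] (s : Finset ι) (c : ℝ) {f : ι → E → ℝ} {x : E}
    (hf : ∀ i ∈ s, DifferentiableAt ℝ (f i) x) :
    gradient (fun z => c * ∑ i ∈ s, f i z) x = c • ∑ i ∈ s, gradient (f i) x := by
  have h : HasFDerivAt (fun z => c * ∑ i ∈ s, f i z) (c • ∑ i ∈ s, fderiv ℝ (f i) x) x :=
    (HasFDerivAt.fun_sum fun i hi => (hf i hi).hasFDerivAt).const_mul c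
  simp only [gradient, h.fderiv, map_smulₛₗ, map_sum, conj_trivial]

/-- Removing one term from an average of `N ≥ 2` vectors of norm at most `g` moves it by at most
`2 * g / (N - 1)`. -/
theorem norm_leave_one_out_average_sub_average_le {E : Type*} [NormedAddCommGroup E]
    [NormedSpace ℝ E] {N : ℕ} (hN : 2 ≤ N) (v : Fin N → E) (j : Fin N) {g : ℝ}
    (hv : ∀ i, ‖v i‖ ≤ g) :
    ‖(1 / ((N : ℝ) - 1)) • ∑ i ∈ Finset.univ.filter (fun i => i ≠ j), v i -
        (1 / (N : ℝ)) • ∑ i, v i‖ ≤ 2 * g / ((N : ℝ) - 1) := by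
  have hN' : (2 : ℝ) ≤ N := by exact_mod_cast hN
  have hN0 : (0 : ℝ) < N := by linarith
  have hN1 : (0 : ℝ) < (N : ℝ) - 1 := by linarith
  have hg : 0 ≤ g := (norm_nonneg _).trans (hv j)
  rw [Finset.filter_ne', ← Finset.add_sum_erase _ v (Finset.mem_univ j)]
  set S := ∑ i ∈ Finset.univ.erase j, v i with hS
  have hSn : ‖S‖ ≤ ((N : ℝ) - 1) * g := by
    have h := norm_sum_le_of_le (Finset.univ.erase j) fun i _ => hv i
    rwa [Finset.sum_const, Finset.card_erase_of_mem (Finset.mem_univ j), Finset.card_univ,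
      Fintype.card_fin, nsmul_eq_mul, Nat.cast_sub (by omega), Nat.cast_one] at h
  have hsplit : (1 / ((N : ℝ) - 1)) • S - (1 / (N : ℝ)) • (v j + S) =
      (1 / ((N : ℝ) * (N - 1))) • S - (1 / (N : ℝ)) • v j := by
    have hc : 1 / ((N : ℝ) * (N - 1)) = 1 / ((N : ℝ) - 1) - 1 / N := by
      field_simp
      ring
    rw [hc]
    module
  rw [hsplit]
  calc
    _ ≤ ‖(1 / ((N : ℝ) * (N - 1))) • S‖ + ‖(1 / (N : ℝ)) • v j‖ := norm_sub_le _ _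
    _ = 1 / ((N : ℝ) * (N - 1)) * ‖S‖ + 1 / (N : ℝ) * ‖v j‖ := by
      rw [norm_smul_of_nonneg (by positivity), norm_smul_of_nonneg (by positivity)]
    _ ≤ 1 / ((N : ℝ) * (N - 1)) * (((N : ℝ) - 1) * g) + 1 / (N : ℝ) * g := by
      gcongr
      exact hv j
    _ = 2 * g / N := by
      field_simp
      ring
    _ ≤ 2 * g / ((N : ℝ) - 1) := by
      gcongr
      linarith


/-- One-step stability of the leave-one-out parameter gap: with uniformly bounded sample
gradients (`g`), a `K`-Lipschitz full-batch gradient map, and `η t ≥ 0`,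
`‖θ₋ⱼ^{t+1} − θ^{t+1}‖ ≤ (1 + η t K) ‖θ₋ⱼ^t − θ^t‖ + 2 η t g/(N−1)`. -/
theorem loo_one_step_stability
    (p N : ℕ) (hN : 2 ≤ N)
    (ℓ : Fin N → EuclideanSpace ℝ (Fin p) → ℝ) (j : Fin N)
    (g K : ℝ) (η : ℕ → ℝ) (hη : ∀ t, 0 ≤ η t)
    (hdiff : ∀ i, Differentiable ℝ (ℓ i))
    (hbound : ∀ i (x : EuclideanSpace ℝ (Fin p)), ‖gradient (ℓ i) x‖ ≤ g)
    (hlip : ∀ x y : EuclideanSpace ℝ (Fin p),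
      ‖gradient (fun z => (1 / (N : ℝ)) * ∑ i, ℓ i z) x -
          gradient (fun z => (1 / (N : ℝ)) * ∑ i, ℓ i z) y‖ ≤ K * ‖x - y‖)
    (θ θmj : ℕ → EuclideanSpace ℝ (Fin p))
    (hθ : ∀ t, θ (t + 1) =
      θ t - η t • gradient (fun x => (1 / (N : ℝ)) * ∑ i, ℓ i x) (θ t))
    (hθmj : ∀ t, θmj (t + 1) =
      θmj t - η t • gradient
        (fun x => (1 / ((N : ℝ) - 1)) *
          ∑ i ∈ Finset.univ.filter (fun i => i ≠ j), ℓ i x) (θmj t))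
    (hinit : θmj 0 = θ 0) (t : ℕ) :
    ‖θmj (t + 1) - θ (t + 1)‖ ≤
      (1 + η t * K) * ‖θmj t - θ t‖ + 2 * η t * g / ((N : ℝ) - 1) := by
  have hgap := norm_leave_one_out_average_sub_average_le hN
    (fun i => gradient (ℓ i) (θmj t)) j fun i => hbound i _
  rw [← gradient_const_mul_sum _ _ fun i _ => hdiff i _,
    ← gradient_const_mul_sum _ _ fun i _ => hdiff i _] at hgap
  have hL := hlip (θmj t) (θ t)
  rw [hθ, hθmj]
  set a := gradient (fun x => (1 / ((N : ℝ) - 1)) *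
    ∑ i ∈ Finset.univ.filter (fun i => i ≠ j), ℓ i x) (θmj t)
  set b := gradient (fun x => (1 / (N : ℝ)) * ∑ i, ℓ i x) (θmj t)
  set c := gradient (fun x => (1 / (N : ℝ)) * ∑ i, ℓ i x) (θ t)
  calc
    _ = ‖(θmj t - θ t) - η t • ((b - c) + (a - b))‖ := by
      congr 1
      module
    _ ≤ ‖θmj t - θ t‖ + η t * (‖b - c‖ + ‖a - b‖) := by
      refine (norm_sub_le _ _).trans ?_
      rw [norm_smul_of_nonneg (hη t)]
      gcongr
      · exact hη t
      · exact norm_add_le _ _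
    _ ≤ ‖θmj t - θ t‖ + η t * (K * ‖θmj t - θ t‖ + 2 * g / ((N : ℝ) - 1)) := by
      gcongr
      exact hη t
    _ = _ := by ring
end
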